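/- arXiv:2111.12865 — 3 statements merged into one kernel-verified Lean document; each statement's English description precedes it below -/
import Mathlib

section
/- Let E be a real inner product space and f : E → ℝ a differentiable convex function that is λ-smooth for some λ > 0. Then for all v, w ∈ E, ⟨∇f(v) − ∇f(w), v − w⟩ ≥ (1/λ)·‖∇f(v) − ∇f(w)‖². -/
open scoped RealInnerProductSpace

section

variable {E : Type*} [NormedAddCommGroup E] [InnerProductSpace ℝ E] {f : E → ℝ} {f' : E → E}

theorem hasDerivAt_comp_add_smul_of_hasFDerivAt_innerSL
    (hdiff : ∀ x, HasFDerivAt f (innerSL ℝ (f' x)) x) (x d : E) (t : ℝ) :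
    HasDerivAt (fun s : ℝ => f (x + s • d)) ⟪f' (x + t • d), d⟫ t := by
  have hline : HasDerivAt (fun s : ℝ => x + s • d) d t := by
    simpa using ((hasDerivAt_id t).smul_const d).const_add x
  exact (hdiff (x + t • d)).comp_hasDerivAt t hline

/-- A differentiable convex function lies above its tangent hyperplanes. -/
theorem add_inner_le_of_convexOn
    (hdiff : ∀ x, HasFDerivAt f (innerSL ℝ (f' x)) x) (hconv : ConvexOn ℝ Set.univ f) (x d : E) :
    f x + ⟪f' x, d⟫ ≤ f (x + d) := by
  have hc : ConvexOn ℝ Set.univ (fun s : ℝ => f (x + s • d)) := by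
    refine ⟨convex_univ, fun s _ t _ a b ha hb hab => ?_⟩
    have h := hconv.2 (Set.mem_univ (x + s • d)) (Set.mem_univ (x + t • d)) ha hb hab
    have hcomb : x + (a • s + b • t) • d = a • (x + s • d) + b • (x + t • d) := by
      obtain rfl : b = 1 - a := by linarith
      module
    simpa only [hcomb] using h
  have h := hc.le_slope_of_hasDerivAt (Set.mem_univ 0) (Set.mem_univ 1) zero_lt_one
    (hasDerivAt_comp_add_smul_of_hasFDerivAt_innerSL hdiff x d 0)
  simp [slope_def_field] at h
  linarith

/-- The descent lemma: a function with `lam`-Lipschitz gradient lies below its tangent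
paraboloids of curvature `lam`. -/
theorem le_add_inner_add_sq_norm_of_smooth
    (hdiff : ∀ x, HasFDerivAt f (innerSL ℝ (f' x)) x) {lam : ℝ}
    (hsmooth : ∀ u v, ‖f' u - f' v‖ ≤ lam * ‖u - v‖) (x d : E) :
    f (x + d) ≤ f x + ⟪f' x, d⟫ + lam / 2 * ‖d‖ ^ 2 := by
  have hderiv (t : ℝ) : HasDerivAt
      (fun s : ℝ => f (x + s • d) - s * ⟪f' x, d⟫ - s ^ 2 * (lam / 2 * ‖d‖ ^ 2))
      (⟪f' (x + t • d), d⟫ - ⟪f' x, d⟫ - 2 * t * (lam / 2 * ‖d‖ ^ 2)) t := by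
    refine (((hasDerivAt_comp_add_smul_of_hasFDerivAt_innerSL hdiff x d t).sub
      ((hasDerivAt_id t).mul_const ⟪f' x, d⟫)).sub
      ((hasDerivAt_pow 2 t).mul_const (lam / 2 * ‖d‖ ^ 2))).congr_deriv ?_
    simp
  have hanti := antitoneOn_of_deriv_nonpos (convex_Icc (0 : ℝ) 1)
    (fun t _ => (hderiv t).continuousAt.continuousWithinAt)
    (fun t _ => (hderiv t).differentiableAt.differentiableWithinAt) (fun t ht => by
      rw [interior_Icc] at ht
      rw [(hderiv t).deriv, ← inner_sub_left]
      have hinner := real_inner_le_norm (f' (x + t • d) - f' x) d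
      have hlip := hsmooth (x + t • d) x
      rw [add_sub_cancel_left, norm_smul, Real.norm_of_nonneg ht.1.le] at hlip
      have hmul := mul_le_mul_of_nonneg_right hlip (norm_nonneg d)
      linarith)
  have h := hanti (Set.left_mem_Icc.2 zero_le_one) (Set.right_mem_Icc.2 zero_le_one) zero_le_one
  simp at h
  linarith

theorem add_inner_add_sq_norm_sub_le_of_convex_smooth
    (hdiff : ∀ x, HasFDerivAt f (innerSL ℝ (f' x)) x) (hconv : ConvexOn ℝ Set.univ f)
    {lam : ℝ} (hlam : 0 < lam) (hsmooth : ∀ u v, ‖f' u - f' v‖ ≤ lam * ‖u - v‖) (v w : E) :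
    f v + ⟪f' v, w - v⟫ + 1 / (2 * lam) * ‖f' v - f' w‖ ^ 2 ≤ f w := by
  set g := f' v - f' w with hg
  have hlower := add_inner_le_of_convexOn hdiff hconv v (w - v + lam⁻¹ • g)
  have hupper := le_add_inner_add_sq_norm_of_smooth hdiff hsmooth w (lam⁻¹ • g)
  rw [← add_assoc, add_sub_cancel, inner_add_right, inner_smul_right] at hlower
  rw [inner_smul_right, norm_smul, Real.norm_of_nonneg (inv_nonneg.2 hlam.le)] at hupper
  have hsq : ⟪f' v, g⟫ - ⟪f' w, g⟫ = ‖g‖ ^ 2 := by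
    rw [← inner_sub_left, ← hg, real_inner_self_eq_norm_sq]
  have hstep : lam⁻¹ * ⟪f' v, g⟫ - lam⁻¹ * ⟪f' w, g⟫ - lam / 2 * (lam⁻¹ * ‖g‖) ^ 2 =
      1 / (2 * lam) * ‖g‖ ^ 2 := by
    rw [← mul_sub, hsq]
    field_simp
    ring
  linarith

end

/-- Co-coerciveness: a differentiable convex `lam`-smooth function has
`(1/lam)`-co-coercive gradient. -/
theorem cocoercive_of_convex_smooth
    {E : Type*} [NormedAddCommGroup E] [InnerProductSpace ℝ E]
    (f : E → ℝ) (f' : E → E)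
    (hdiff : ∀ x, HasFDerivAt f (innerSL ℝ (f' x)) x)
    (hconv : ConvexOn ℝ Set.univ f)
    (lam : ℝ) (hlam : 0 < lam)
    (hsmooth : ∀ u v, ‖f' u - f' v‖ ≤ lam * ‖u - v‖) :
    ∀ v w, ⟪f' v - f' w, v - w⟫ ≥ (1 / lam) * ‖f' v - f' w‖ ^ 2 := by
  intro v w
  have hvw := add_inner_add_sq_norm_sub_le_of_convex_smooth hdiff hconv hlam hsmooth v w
  have hwv := add_inner_add_sq_norm_sub_le_of_convex_smooth hdiff hconv hlam hsmooth w v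
  rw [norm_sub_rev (f' w)] at hwv
  rw [← neg_sub v w, inner_neg_right] at hvw
  have hhalf : 1 / lam * ‖f' v - f' w‖ ^ 2 = 2 * (1 / (2 * lam) * ‖f' v - f' w‖ ^ 2) := by
    field_simp
  rw [inner_sub_left]
  linarith
end

section
/- Let E be a real inner product space, f : E → ℝ differentiable, γ-strongly convex, and λ-smooth with 0 < γ ≤ λ, and let 0 ≤ α ≤ 2/(λ + γ). Then the gradient-update map G(w) = w − α·∇f(w) is (1 − αλγ/(λ+γ))-Lipschitz: for all u, v ∈ E, ‖G(u) − G(v)‖ ≤ (1 − αλγ/(λ+γ))·‖u − v‖. -/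
open scoped RealInnerProductSpace

/-- Descent lemma: a function with `L`-Lipschitz gradient lies below its quadratic upper models. -/
theorem le_quadratic_of_lipschitz_gradient
    {E : Type*} [NormedAddCommGroup E] [InnerProductSpace ℝ E]
    {f : E → ℝ} {f' : E → E} {L : ℝ}
    (hdiff : ∀ x, HasFDerivAt f (innerSL ℝ (f' x)) x)
    (hsmooth : ∀ u v, ‖f' u - f' v‖ ≤ L * ‖u - v‖) (u v : E) :
    f u ≤ f v + ⟪f' v, u - v⟫ + L / 2 * ‖u - v‖ ^ 2 := by
  set s := u - v with hs
  have hline : ∀ t : ℝ, HasDerivAt (fun t : ℝ => v + t • s) s t := fun t => by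
    simpa using ((hasDerivAt_id t).smul_const s).const_add v
  have hderiv : ∀ t : ℝ, HasDerivAt
      (fun t : ℝ => f (v + t • s) - t * ⟪f' v, s⟫ - L / 2 * ‖s‖ ^ 2 * t ^ 2)
      (⟪f' (v + t • s), s⟫ - ⟪f' v, s⟫ - L * ‖s‖ ^ 2 * t) t := fun t => by
    have h₁ : HasDerivAt (fun t : ℝ => f (v + t • s)) ⟪f' (v + t • s), s⟫ t := by
      exact (hdiff (v + t • s)).comp_hasDerivAt t (hline t)
    have h₂ := (hasDerivAt_id t).mul_const ⟪f' v, s⟫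
    have h₃ := (hasDerivAt_pow 2 t).const_mul (L / 2 * ‖s‖ ^ 2)
    refine ((h₁.sub h₂).sub h₃).congr_deriv ?_
    norm_num
    ring
  have hanti : AntitoneOn
      (fun t : ℝ => f (v + t • s) - t * ⟪f' v, s⟫ - L / 2 * ‖s‖ ^ 2 * t ^ 2)
      (Set.Icc 0 1) := by
    refine antitoneOn_of_deriv_nonpos (convex_Icc 0 1)
      (fun t _ => (hderiv t).continuousAt.continuousWithinAt)
      (fun t _ => (hderiv t).differentiableAt.differentiableWithinAt) fun t ht => ?_
    rw [interior_Icc] at ht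
    rw [(hderiv t).deriv, ← inner_sub_left]
    have h₁ := real_inner_le_norm (f' (v + t • s) - f' v) s
    have h₂ := hsmooth (v + t • s) v
    rw [add_sub_cancel_left, norm_smul, Real.norm_of_nonneg ht.1.le] at h₂
    nlinarith [mul_le_mul_of_nonneg_right h₂ (norm_nonneg s)]
  have h := hanti (Set.left_mem_Icc.2 zero_le_one) (Set.right_mem_Icc.2 zero_le_one) zero_le_one
  simp only [one_smul, zero_smul, add_zero, hs, add_sub_cancel] at h
  linarith

/-- Cocoercivity of the gradient of a convex function with quadratic upper models of
curvature `L`. The case `L = 0` is included. -/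
theorem norm_sq_gradient_sub_le_mul_inner
    {E : Type*} [NormedAddCommGroup E] [InnerProductSpace ℝ E]
    {h : E → ℝ} {h' : E → E} {L : ℝ} (hL : 0 ≤ L)
    (hlower : ∀ u v, h v + ⟪h' v, u - v⟫ ≤ h u)
    (hupper : ∀ u v, h u ≤ h v + ⟪h' v, u - v⟫ + L / 2 * ‖u - v‖ ^ 2) (u v : E) :
    ‖h' u - h' v‖ ^ 2 ≤ L * ⟪h' u - h' v, u - v⟫ := by
  have hstep : ∀ (t : ℝ) (x y : E),
      h x + ⟪h' x, y - x⟫ + (t - L / 2 * t ^ 2) * ‖h' y - h' x‖ ^ 2 ≤ h y := fun t x y => by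
    have h₁ := hlower (y - t • (h' y - h' x)) x
    have h₂ := hupper (y - t • (h' y - h' x)) y
    rw [sub_right_comm, inner_sub_right, inner_smul_right] at h₁
    rw [sub_sub_cancel_left, inner_neg_right, inner_smul_right, norm_neg, norm_smul, mul_pow,
      Real.norm_eq_abs, sq_abs] at h₂
    have h₃ : ⟪h' y, h' y - h' x⟫ - ⟪h' x, h' y - h' x⟫ = ‖h' y - h' x‖ ^ 2 := by
      rw [← inner_sub_left, real_inner_self_eq_norm_sq]
    linear_combination h₁ + h₂ - t * h₃
  have hsum : ∀ t : ℝ, (2 * t - L * t ^ 2) * ‖h' u - h' v‖ ^ 2 ≤ ⟪h' u - h' v, u - v⟫ :=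
      fun t => by
    have h₁ := hstep t u v
    have h₂ := hstep t v u
    rw [norm_sub_rev, ← neg_sub u v, inner_neg_right] at h₁
    rw [inner_sub_left]
    linarith
  rcases hL.eq_or_lt with rfl | hL
  · by_contra! hpos
    rw [zero_mul] at hpos
    have h₁ := hsum ((⟪h' u - h' v, u - v⟫ + 1) / (2 * ‖h' u - h' v‖ ^ 2))
    rw [zero_mul, sub_zero, ← mul_div_assoc, div_mul_eq_mul_div,
      div_le_iff₀ (by positivity)] at h₁
    nlinarith
  · have h₁ := mul_le_mul_of_nonneg_left (hsum L⁻¹) hL.le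
    refine le_trans (le_of_eq ?_) h₁
    field_simp
    ring

/-- Coercivity of the gradient of a strongly convex function with Lipschitz gradient. -/
theorem norm_sq_add_le_mul_inner_gradient_sub
    {E : Type*} [NormedAddCommGroup E] [InnerProductSpace ℝ E]
    {f : E → ℝ} {f' : E → E} {γ L : ℝ}
    (hdiff : ∀ x, HasFDerivAt f (innerSL ℝ (f' x)) x) (hγL : γ ≤ L)
    (hsc : ∀ u v, f u - f v ≥ ⟪f' v, u - v⟫ + γ / 2 * ‖u - v‖ ^ 2)
    (hsmooth : ∀ u v, ‖f' u - f' v‖ ≤ L * ‖u - v‖) (u v : E) :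
    ‖f' u - f' v‖ ^ 2 + L * γ * ‖u - v‖ ^ 2 ≤ (L + γ) * ⟪f' u - f' v, u - v⟫ := by
  have hquad : ∀ x y : E, ‖x‖ ^ 2 = ‖y‖ ^ 2 + 2 * ⟪y, x - y⟫ + ‖x - y‖ ^ 2 := fun x y => by
    rw [← norm_add_sq_real, add_sub_cancel]
  have key := norm_sq_gradient_sub_le_mul_inner (h := fun x => f x - γ / 2 * ‖x‖ ^ 2)
    (h' := fun x => f' x - γ • x) (sub_nonneg.2 hγL)
    (fun x y => by
      simp only [inner_sub_left, real_inner_smul_left]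
      linear_combination hsc x y + γ / 2 * hquad x y)
    (fun x y => by
      simp only [inner_sub_left, real_inner_smul_left]
      linear_combination le_quadratic_of_lipschitz_gradient hdiff hsmooth x y
        - γ / 2 * hquad x y) u v
  have hg : f' u - γ • u - (f' v - γ • v) = (f' u - f' v) - γ • (u - v) := by
    rw [smul_sub]
    abel
  simp only [hg] at key
  rw [norm_sub_sq_real, inner_sub_left (f' u - f' v), real_inner_smul_left,
    real_inner_smul_right, norm_smul, mul_pow, Real.norm_eq_abs, sq_abs,
    real_inner_self_eq_norm_sq] at key
  linarith

/-- The gradient-update map of a `γ`-strongly convex `lam`-smooth function with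
step size `α ≤ 2/(lam + γ)` is `(1 - α·lam·γ/(lam+γ))`-Lipschitz. -/
theorem gradientUpdate_contraction_of_stronglyConvex_smooth
    {E : Type*} [NormedAddCommGroup E] [InnerProductSpace ℝ E]
    (f : E → ℝ) (f' : E → E)
    (hdiff : ∀ x, HasFDerivAt f (innerSL ℝ (f' x)) x)
    (γ lam : ℝ) (hγ : 0 < γ) (hgl : γ ≤ lam)
    (hsc : ∀ u v, f u - f v ≥ ⟪f' v, u - v⟫ + γ / 2 * ‖u - v‖ ^ 2)
    (hsmooth : ∀ u v, ‖f' u - f' v‖ ≤ lam * ‖u - v‖)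
    (α : ℝ) (hα₀ : 0 ≤ α) (hα : α ≤ 2 / (lam + γ)) :
    ∀ u v, ‖(u - α • f' u) - (v - α • f' v)‖ ≤ (1 - α * lam * γ / (lam + γ)) * ‖u - v‖ := by
  intro u v
  have hsum : 0 < lam + γ := by linarith
  have hcoer := norm_sq_add_le_mul_inner_gradient_sub hdiff hgl hsc hsmooth u v
  have hα' : α * (lam + γ) ≤ 2 := (le_div_iff₀ hsum).1 hα
  have hnonneg : 0 ≤ 1 - α * lam * γ / (lam + γ) := by
    rw [sub_nonneg, div_le_one hsum]
    nlinarith [mul_le_mul_of_nonneg_right hα' hsum.le,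
      mul_nonneg hα₀ (sq_nonneg (lam - γ))]
  refine (sq_le_sq₀ (norm_nonneg _) (mul_nonneg hnonneg (norm_nonneg _))).1 ?_
  have hG : (u - α • f' u) - (v - α • f' v) = (u - v) - α • (f' u - f' v) := by
    rw [smul_sub]
    abel
  rw [hG, norm_sub_sq_real, real_inner_smul_right, real_inner_comm, norm_smul, mul_pow,
    Real.norm_eq_abs, sq_abs]
  set c := lam * γ / (lam + γ) with hc
  have hcα : α * lam * γ / (lam + γ) = α * c := by
    rw [hc]
    ring
  have hinner : ‖f' u - f' v‖ ^ 2 / (lam + γ) + c * ‖u - v‖ ^ 2 ≤ ⟪f' u - f' v, u - v⟫ := by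
    rw [hc, div_mul_eq_mul_div, ← add_div, div_le_iff₀ hsum]
    linarith
  have hstep : α ^ 2 * ‖f' u - f' v‖ ^ 2 ≤ 2 * α * (‖f' u - f' v‖ ^ 2 / (lam + γ)) := by
    have h := mul_le_mul_of_nonneg_left hα (mul_nonneg hα₀ (sq_nonneg ‖f' u - f' v‖))
    linear_combination h
  rw [hcα]
  linear_combination 2 * mul_le_mul_of_nonneg_left hinner hα₀ + hstep
    + sq_nonneg (α * c * ‖u - v‖)
end

section
/- Let 0 < Z < 1 and Y ≥ 0 be real numbers and let v : ℕ → ℝ be a sequence with v(0) = 0 and, for all t, v(t+1) ≤ Z²·v(t) + 2YZ·x(t) + Y², where x(t) = Y·(1 − Z^t)/(1 − Z). Then for every T ≥ 0, v(T) ≤ 2Y²·(Z^T − Z^{2T})/(Z − Z²) + Y²·(1 − Z^T)/(1 − Z)². -/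
/-- Closed-form solution of the second-moment stability recursion. -/
theorem second_moment_recursion_bound (Z Y : ℝ) (hZ0 : 0 < Z) (hZ1 : Z < 1) (hY : 0 ≤ Y)
    (x v : ℕ → ℝ) (hx : ∀ t, x t = Y * (1 - Z ^ t) / (1 - Z))
    (h0 : v 0 = 0)
    (hrec : ∀ t, v (t + 1) ≤ Z ^ 2 * v t + 2 * Y * Z * x t + Y ^ 2) :
    ∀ T, v T ≤ 2 * Y ^ 2 * (Z ^ T - Z ^ (2 * T)) / (Z - Z ^ 2)
      + Y ^ 2 * (1 - Z ^ T) / (1 - Z) ^ 2 := by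
  have hZ : 0 < 1 - Z := sub_pos.mpr hZ1
  have hx_succ : ∀ t, x (t + 1) = Z * x t + Y := by
    intro t
    rw [hx, hx, pow_succ]
    field_simp
    ring
  have hv : ∀ t, v t ≤ x t ^ 2 := by
    intro t
    induction t with
    | zero => simp [h0, hx]
    | succ t ih =>
      rw [hx_succ]
      nlinarith [hrec t, mul_le_mul_of_nonneg_left ih (sq_nonneg Z)]
  intro T
  have ha0 : 0 ≤ Z ^ T := by positivity
  have ha1 : 0 ≤ 1 - Z ^ T := sub_nonneg.mpr (pow_le_one₀ hZ0.le hZ1.le)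
  have hfirst : 0 ≤ 2 * Y ^ 2 * (Z ^ T - Z ^ (2 * T)) / (Z - Z ^ 2) := by
    have hnum : Z ^ T - Z ^ (2 * T) = Z ^ T * (1 - Z ^ T) := by ring
    have hden : Z - Z ^ 2 = Z * (1 - Z) := by ring
    rw [hnum, hden]
    positivity
  have hsecond : x T ^ 2 ≤ Y ^ 2 * (1 - Z ^ T) / (1 - Z) ^ 2 := by
    rw [hx, div_pow, mul_pow]
    gcongr
    nlinarith
  linarith [hv T]
end
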